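/- Let Γ be a countable discrete abelian group, B ⊆ Γ with upper Banach density d*(B) = δ > 0, and F ⊆ ℤ a finite set. Then the set R = {(γ_1,γ_2) ∈ Γ² : γ_1 + kγ_2 ∈ B for all k ∈ F} has positive upper Banach density in Γ², with a lower bound depending only on δ and |F|. (This follows from the uniform multiple recurrence theorem: for every measure-preserving Γ-system (X,μ,T), every measurable E with μ(E) ≥ δ, and every F ⊆ ℤ with |F| ≤ k, the uniform Cesàro average over γ of μ(∩_{j∈F} T^{-jγ}E) is at least some c = c(k,δ) > 0.) -/

import Mathlib

open Filter Topology

/-- A *Følner sequence* in a discrete abelian group `Γ`. -/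
def IsFolner {Γ : Type*} [AddCommGroup Γ] (Φ : ℕ → Finset Γ) : Prop :=
  (∀ N, (Φ N).Nonempty) ∧
    ∀ γ : Γ, Tendsto
      (fun N => ((((Φ N : Set Γ)) ∩ ((· + γ) '' (Φ N : Set Γ))).ncard : ℝ) / (Φ N).card)
      atTop (nhds 1)

/-- The *upper Banach density* of `A ⊆ Γ`: the supremum over all Følner sequences `Φ` of
`limsup_N |A ∩ Φ_N| / |Φ_N|`. -/
noncomputable def upperBanachDensity {Γ : Type*} [AddCommGroup Γ] (A : Set Γ) : ℝ :=
  sSup {x : ℝ | ∃ Φ : ℕ → Finset Γ, IsFolner Φ ∧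
    x = limsup (fun N => ((A ∩ (Φ N : Set Γ)).ncard : ℝ) / (Φ N).card) atTop}

namespace USz

/-- Average of a real function on a finite type. -/
noncomputable def avg {X : Type} [Finite X] (f : X → ℝ) : ℝ :=
  (∑ x ∈ (Set.finite_univ (α := X)).toFinset, f x) / Nat.card X

/-- Real indicator function of a set. -/
noncomputable def ind {X : Type} (s : Set X) : X → ℝ := s.indicator (fun _ => 1)

/-- Density of a set in a finite type. -/
noncomputable def dens {X : Type} [Finite X] (s : Set X) : ℝ := avg (ind s)

section avg
variable {X Y : Type} [Finite X] [Finite Y]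

lemma avg_eq [Fintype X] (f : X → ℝ) : avg f = (∑ x, f x) / Nat.card X := by
  unfold avg
  congr 1
  apply Finset.sum_congr
  · ext; simp
  · intros; rfl

lemma card_pos' [Nonempty X] : (0 : ℝ) < Nat.card X := by
  exact_mod_cast Nat.card_pos

lemma avg_const [Nonempty X] (c : ℝ) : avg (fun _ : X => c) = c := by
  have := Fintype.ofFinite X
  have h := card_pos' (X := X)
  rw [avg_eq]; simp only [Finset.sum_const, Finset.card_univ, nsmul_eq_mul, ← Nat.card_eq_fintype_card]
  field_simp

lemma avg_add (f g : X → ℝ) : avg (fun x => f x + g x) = avg f + avg g := by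
  simp only [avg, Finset.sum_add_distrib, add_div]

lemma avg_sub (f g : X → ℝ) : avg (fun x => f x - g x) = avg f - avg g := by
  simp only [avg, Finset.sum_sub_distrib, sub_div]

lemma avg_const_mul (c : ℝ) (f : X → ℝ) : avg (fun x => c * f x) = c * avg f := by
  simp only [avg, ← Finset.mul_sum, mul_div_assoc]

lemma avg_sum {ι : Type} (s : Finset ι) (f : ι → X → ℝ) :
    avg (fun x => ∑ i ∈ s, f i x) = ∑ i ∈ s, avg (f i) := by
  simp only [avg, ← Finset.sum_div]
  rw [Finset.sum_comm]

lemma avg_mono {f g : X → ℝ} (h : ∀ x, f x ≤ g x) : avg f ≤ avg g := by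
  unfold avg
  gcongr with i
  exact h i

lemma avg_nonneg {f : X → ℝ} (h : ∀ x, 0 ≤ f x) : 0 ≤ avg f := by
  unfold avg
  exact div_nonneg (Finset.sum_nonneg fun i _ => h i) (by positivity)

lemma avg_le [Nonempty X] {f : X → ℝ} {c : ℝ} (h : ∀ x, f x ≤ c) : avg f ≤ c :=
  (avg_mono h).trans_eq (avg_const c)

lemma le_avg [Nonempty X] {f : X → ℝ} {c : ℝ} (h : ∀ x, c ≤ f x) : c ≤ avg f :=
  (avg_const c).symm.trans_le (avg_mono h)

lemma exists_le_of_le_avg [Nonempty X] {f : X → ℝ} {c : ℝ} (h : c ≤ avg f) : ∃ x, c ≤ f x := by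
  by_contra! H
  have := Fintype.ofFinite X
  have : avg f < c := by
    rw [avg_eq, div_lt_iff₀ card_pos']
    calc ∑ x, f x < ∑ x : X, c := Finset.sum_lt_sum_of_nonempty Finset.univ_nonempty fun i _ => H i
      _ = _ := by simp [mul_comm]
  linarith

lemma avg_equiv (e : X ≃ Y) (f : Y → ℝ) : avg (fun x => f (e x)) = avg f := by
  have := Fintype.ofFinite X
  have := Fintype.ofFinite Y
  rw [avg_eq, avg_eq, Nat.card_congr e, Equiv.sum_comp e f]

lemma avg_prod (f : X → Y → ℝ) :
    avg (fun p : X × Y => f p.1 p.2) = avg (fun y => avg (fun x => f x y)) := by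
  have := Fintype.ofFinite X
  have := Fintype.ofFinite Y
  simp only [avg_eq, Nat.card_prod, Fintype.sum_prod_type, ← Finset.sum_div]
  rw [Finset.sum_comm, div_div]; push_cast; rfl

lemma avg_comm (f : X → Y → ℝ) :
    avg (fun x => avg (fun y => f x y)) = avg (fun y => avg (fun x => f x y)) := by
  rw [← avg_prod f, ← avg_prod (fun y x => f x y)]
  exact (avg_equiv (Equiv.prodComm Y X) (fun p => f p.1 p.2))

/-- sum over an injective image. -/
lemma avg_ind_range {φ : X → Y} (hφ : Function.Injective φ) (g : Y → ℝ) :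
    avg (fun y => ind (Set.range φ) y * g y) * Nat.card Y = avg (fun x => g (φ x)) * Nat.card X := by
  classical
  have := Fintype.ofFinite X
  have := Fintype.ofFinite Y
  rcases isEmpty_or_nonempty X with hX | hX
  · simp [avg, ind]
  have : Nonempty Y := ⟨φ hX.some⟩
  rw [avg_eq, avg_eq, div_mul_cancel₀ _ card_pos'.ne', div_mul_cancel₀ _ card_pos'.ne']
  have h : ∑ x, g (φ x) = ∑ y ∈ Finset.univ.image φ, g y := by
    rw [Finset.sum_image]
    intro a _ b _ h; exact hφ h
  rw [h, ← Finset.sum_subset (Finset.subset_univ (Finset.univ.image φ))]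
  · apply Finset.sum_congr rfl
    intro y hy
    have : y ∈ Set.range φ := by simpa using hy
    simp [ind, this]
  · intro y _ hy
    have : y ∉ Set.range φ := by simpa using hy
    simp [ind, this]

lemma ind_of_mem {X : Type} {s : Set X} {x : X} (h : x ∈ s) : ind s x = 1 := by simp [ind, h]
lemma ind_of_notMem {X : Type} {s : Set X} {x : X} (h : x ∉ s) : ind s x = 0 := by simp [ind, h]
lemma ind_nonneg {X : Type} (s : Set X) (x : X) : 0 ≤ ind s x := by
  by_cases h : x ∈ s <;> simp [ind, h]
lemma ind_le_one {X : Type} (s : Set X) (x : X) : ind s x ≤ 1 := by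
  by_cases h : x ∈ s <;> simp [ind, h]
lemma ind_mono {X : Type} {s t : Set X} (h : s ⊆ t) (x : X) : ind s x ≤ ind t x := by
  by_cases hs : x ∈ s
  · simp [ind, hs, h hs]
  · rw [ind_of_notMem hs]; exact ind_nonneg _ _
lemma ind_compl {X : Type} (s : Set X) (x : X) : ind sᶜ x = 1 - ind s x := by
  by_cases h : x ∈ s <;> simp [ind, h]
lemma ind_inter {X : Type} (s t : Set X) (x : X) : ind (s ∩ t) x = ind s x * ind t x := by
  by_cases h : x ∈ s <;> by_cases h' : x ∈ t <;> simp [ind, h, h']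
lemma ind_congr {X Z : Type} {s : Set X} {t : Set Z} {x : X} {z : Z} (h : x ∈ s ↔ z ∈ t) :
    ind s x = ind t z := by
  by_cases hx : x ∈ s
  · rw [ind_of_mem hx, ind_of_mem (h.1 hx)]
  · rw [ind_of_notMem hx, ind_of_notMem (fun hz => hx (h.2 hz))]

lemma dens_nonneg (s : Set X) : 0 ≤ dens s := avg_nonneg (ind_nonneg s)
lemma dens_le_one [Nonempty X] (s : Set X) : dens s ≤ 1 := avg_le (ind_le_one s)
lemma dens_mono {s t : Set X} (h : s ⊆ t) : dens s ≤ dens t := avg_mono (ind_mono h)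

end avg

section words
variable {α ι ι' : Type} [Finite α] [Finite ι] [Finite ι']

lemma avg_split {ρ : Type} [Finite ρ] (e : ι ⊕ ρ ≃ ι') (f : (ι' → α) → ℝ) :
    avg f = avg (fun y : ρ → α => avg (fun x : ι → α => f (fun q => Sum.elim x y (e.symm q)))) := by
  rw [← avg_prod (fun (x : ι → α) (y : ρ → α) => f (fun q => Sum.elim x y (e.symm q)))]
  let E : (ι → α) × (ρ → α) ≃ (ι' → α) :=
    (Equiv.sumArrowEquivProdArrow ι ρ α).symm.trans (Equiv.arrowCongr e (Equiv.refl α))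
  rw [← avg_equiv E]
  rfl

lemma avg_sumElim (f : (ι ⊕ ι' → α) → ℝ) :
    avg f = avg (fun y : ι' → α => avg (fun x : ι → α => f (Sum.elim x y))) :=
  avg_split (Equiv.refl _) f

lemma avg_sumElim' (f : (ι ⊕ ι' → α) → ℝ) :
    avg f = avg (fun x : ι → α => avg (fun y : ι' → α => f (Sum.elim x y))) := by
  rw [avg_sumElim, avg_comm]

end words

/-- Evaluation of a parameter word `φ`, constants interpreted through `h`. -/
def ev {κ α ι η : Type} (h : κ → α) (φ : ι → κ ⊕ η) (x : η → α) : ι → α :=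
  fun i => Sum.elim h x (φ i)

/-- every parameter occurs -/
def Proper {κ ι η : Type} (φ : ι → κ ⊕ η) : Prop := ∀ e, ∃ i, φ i = Sum.inr e

/-- composition of parameter words -/
def comp {κ ι η ζ : Type} (φ : ι → κ ⊕ η) (ψ : η → κ ⊕ ζ) : ι → κ ⊕ ζ :=
  fun i => Sum.elim Sum.inl ψ (φ i)

section ev
variable {κ α ι η ζ : Type}

lemma ev_comp (h : κ → α) (φ : ι → κ ⊕ η) (ψ : η → κ ⊕ ζ) (x : ζ → α) :
    ev h (comp φ ψ) x = ev h φ (ev h ψ x) := by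
  funext i
  simp only [ev, comp]
  rcases φ i with a | e <;> simp [ev]

lemma Proper.comp {φ : ι → κ ⊕ η} {ψ : η → κ ⊕ ζ} (hφ : Proper φ) (hψ : Proper ψ) :
    Proper (USz.comp φ ψ) := by
  intro e
  obtain ⟨j, hj⟩ := hψ e
  obtain ⟨i, hi⟩ := hφ j
  exact ⟨i, by simp [USz.comp, hi, hj]⟩

lemma ev_injective (h : κ → α) {φ : ι → κ ⊕ η} (hφ : Proper φ) : Function.Injective (ev h φ) := by
  intro x y hxy
  funext e
  obtain ⟨i, hi⟩ := hφ e
  have := congrFun hxy i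
  simpa [ev, hi] using this

/-- a subspace in the `ι`-part, with the rest fixed -/
lemma exists_slice {ρ ι' : Type} (e : ι ⊕ ρ ≃ ι') (φ : ι → α ⊕ η) (hφ : Proper φ) (y : ρ → α) :
    ∃ ψ : ι' → α ⊕ η, Proper ψ ∧ ∀ x, ev id ψ x = fun q => Sum.elim (ev id φ x) y (e.symm q) := by
  refine ⟨fun q => Sum.elim φ (fun r => Sum.inl (y r)) (e.symm q), ?_, ?_⟩
  · intro p
    obtain ⟨i, hi⟩ := hφ p
    exact ⟨e (Sum.inl i), by simp [hi]⟩
  · intro x; funext q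
    simp only [ev]
    rcases e.symm q with a | b <;> simp [ev]

end ev

/-- The line with parameter word `ℓ` -/
def line {κ ι : Type} (ℓ : ι → κ ⊕ Unit) (a : κ) : ι → κ := ev id ℓ (fun _ => a)

/-- every set of density at least `δ` contains an `η`-dimensional subspace -/
def MD (α η ι : Type) [Finite α] [Finite ι] (δ : ℝ) : Prop :=
  ∀ A : Set (ι → α), δ ≤ dens A → ∃ φ : ι → α ⊕ η, Proper φ ∧ ∀ x, ev id φ x ∈ A

lemma MD.of_equiv_sum {α η ι ι' ρ : Type} [Nonempty α] [Finite α] [Finite ι] [Finite ι'] [Finite ρ]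
    (e : ι ⊕ ρ ≃ ι') {δ : ℝ} (h : MD α η ι δ) : MD α η ι' δ := by
  intro A hA
  rw [dens, avg_split e] at hA
  obtain ⟨y, hy⟩ := exists_le_of_le_avg hA
  obtain ⟨φ, hφ, h2⟩ := h {x | (fun q => Sum.elim x y (e.symm q)) ∈ A} hy
  obtain ⟨ψ, hψ, h3⟩ := exists_slice e φ hφ y
  exact ⟨ψ, hψ, fun x => by rw [h3]; exact h2 x⟩

lemma exists_equiv_sum {ι ι' : Type} [Finite ι] [Finite ι'] (h : Nat.card ι ≤ Nat.card ι') :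
    ∃ (ρ : Type) (_ : Finite ρ), Nonempty (ι ⊕ ρ ≃ ι') := by
  refine ⟨Fin (Nat.card ι' - Nat.card ι), inferInstance, ?_⟩
  rw [← Finite.card_eq]
  simp; omega

lemma MD.of_card_le {α η ι ι' : Type} [Nonempty α] [Finite α] [Finite ι] [Finite ι']
    (hc : Nat.card ι ≤ Nat.card ι') {δ : ℝ} (h : MD α η ι δ) : MD α η ι' δ := by
  obtain ⟨ρ, _, ⟨e⟩⟩ := exists_equiv_sum hc
  exact h.of_equiv_sum e

lemma MD.mono {α η ι : Type} [Finite α] [Finite ι] {δ δ' : ℝ} (hd : δ ≤ δ') (h : MD α η ι δ) :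
    MD α η ι δ' := fun A hA => h A (hd.trans hA)

/-- `P` holds at the single density `δ`. -/
def DHJat (α : Type) [Finite α] (δ : ℝ) : Prop := ∃ n : ℕ, MD α Unit (Fin n) δ

/-- density Hales-Jewett for the alphabet `α` -/
def DHJ (α : Type) [Finite α] : Prop := ∀ δ : ℝ, 0 < δ → DHJat α δ

lemma DHJat.of_type {α ι : Type} [Nonempty α] [Finite α] [Finite ι] {δ : ℝ} (h : MD α Unit ι δ) :
    DHJat α δ := ⟨Nat.card ι, h.of_card_le (by simp)⟩

/-- a popular line -/
lemma popular {α ι Y : Type} [Finite α] [Finite ι] [Finite Y] [Nonempty Y] {δ : ℝ} (hδ : 0 < δ)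
    (h : MD α Unit ι δ) (B : Y → Set (ι → α)) (hB : 2 * δ ≤ avg (fun y => dens (B y))) :
    ∃ ℓ : ι → α ⊕ Unit, Proper ℓ ∧
      δ / Nat.card (ι → α ⊕ Unit) ≤ dens {y | ∀ a, line ℓ a ∈ B y} := by
  classical
  have := Fintype.ofFinite (ι → α ⊕ Unit)
  let Q : (ι → α ⊕ Unit) → Set Y := fun ℓ => {y | Proper ℓ ∧ ∀ a, line ℓ a ∈ B y}
  have key : ∀ y, dens (B y) ≤ δ + ∑ ℓ, ind (Q ℓ) y := by
    intro y
    have hs : ∀ ℓ ∈ Finset.univ, 0 ≤ ind (Q ℓ) y := fun ℓ _ => ind_nonneg _ _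
    by_cases hy : δ ≤ dens (B y)
    · obtain ⟨ℓ, hℓ, hl⟩ := h _ hy
      have h1 : ind (Q ℓ) y = 1 := ind_of_mem ⟨hℓ, fun a => hl _⟩
      have h2 := Finset.single_le_sum hs (Finset.mem_univ ℓ)
      have : Nonempty (ι → α) := by
        by_contra hne
        rw [not_nonempty_iff] at hne
        have : dens (B y) = 0 := by simp [dens, avg]
        linarith
      have h3 := dens_le_one (B y)
      linarith
    · have := Finset.sum_nonneg hs
      linarith
  have h1 := hB.trans (avg_mono key)
  rw [avg_add, avg_const, avg_sum] at h1
  have hne : (Finset.univ : Finset (ι → α ⊕ Unit)).Nonempty := by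
    rw [Finset.nonempty_iff_ne_empty]; intro h0; rw [h0] at h1; simp at h1; linarith
  have h2 : ∑ ℓ : ι → α ⊕ Unit, δ / Nat.card (ι → α ⊕ Unit) ≤ ∑ ℓ, avg (ind (Q ℓ)) := by
    have : Nonempty (ι → α ⊕ Unit) := ⟨hne.choose⟩
    have hc := card_pos' (X := ι → α ⊕ Unit)
    rw [Finset.sum_const, Finset.card_univ, nsmul_eq_mul, ← Nat.card_eq_fintype_card]
    field_simp
    linarith
  obtain ⟨ℓ, -, hℓ⟩ := Finset.exists_le_of_sum_le hne h2
  have hp : 0 < δ / Nat.card (ι → α ⊕ Unit) := by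
    have : Nonempty (ι → α ⊕ Unit) := ⟨hne.choose⟩
    have hc := card_pos' (X := ι → α ⊕ Unit)
    positivity
  have hpr : Proper ℓ := by
    by_contra hn
    have : Q ℓ = ∅ := by ext; simp [Q, hn]
    rw [this] at hℓ
    have h0 : avg (ind (∅ : Set Y)) = 0 := by simp [ind, avg]
    rw [h0] at hℓ
    linarith
  exact ⟨ℓ, hpr, hℓ.trans (dens_mono fun y hy => hy.2)⟩

/-- multidimensional version -/
lemma DHJ.multi {α : Type} [Nonempty α] [Finite α] (h : DHJ α) (d : ℕ) :
    ∀ δ : ℝ, 0 < δ → ∃ n : ℕ, MD α (Fin d) (Fin n) δ := by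
  induction d with
  | zero =>
    intro δ hδ
    refine ⟨0, fun A hA => ?_⟩
    obtain ⟨x, hx⟩ := exists_le_of_le_avg hA
    have hxA : x ∈ A := by
      by_contra hn
      rw [ind_of_notMem hn] at hx; linarith
    refine ⟨fun i => i.elim0, fun e => e.elim0, fun z => ?_⟩
    convert hxA
  | succ d ih =>
    intro δ hδ
    obtain ⟨n1, h1⟩ := h (δ / 2) (by linarith)
    obtain ⟨n2, h2⟩ := ih (δ / 2 / Nat.card (Fin n1 → α ⊕ Unit)) (by
      have := card_pos' (X := Fin n1 → α ⊕ Unit); positivity)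
    refine ⟨n1 + n2, ?_⟩
    apply MD.of_equiv_sum (ι := Fin n1 ⊕ Fin n2) (ρ := Empty)
      ((Equiv.sumEmpty _ _).trans finSumFinEquiv)
    intro A hA
    rw [dens, avg_sumElim] at hA
    obtain ⟨ℓ, hℓ, hd⟩ := popular (by linarith) h1 (fun y : Fin n2 → α => {x | Sum.elim x y ∈ A})
      (by rw [mul_div_cancel₀ _ (by norm_num : (2:ℝ) ≠ 0)]; exact hA)
    obtain ⟨φ, hφ, hm⟩ := h2 _ hd
    refine ⟨Sum.elim (fun i => (ℓ i).map id (fun _ => 0)) (fun i => (φ i).map id Fin.succ), ?_, ?_⟩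
    · intro e
      refine Fin.cases ?_ (fun e => ?_) e
      · obtain ⟨i, hi⟩ := hℓ ()
        exact ⟨Sum.inl i, by simp [hi]⟩
      · obtain ⟨i, hi⟩ := hφ e
        exact ⟨Sum.inr i, by simp [hi]⟩
    · intro x
      have := hm (fun e => x e.succ) (x 0)
      simp only [Set.mem_ofPred_eq] at this
      convert this using 1
      funext q
      rcases q with i | i
      · simp only [ev, line, Sum.elim_inl]
        rcases ℓ i with a | e <;> simp
      · simp only [ev, Sum.elim_inr]
        rcases φ i with a | e <;> simp

end USz

namespace USz

lemma good {κ : Type} [Finite κ] [Nonempty κ] (μ : Type) [Finite μ] (j : ℕ) :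
    ∀ (S : Type) [Finite S], ∃ (ι : Type) (_ : Finite ι), ∀ G : S → Set (ι → Option κ),
      (∃ s, ∃ φ : ι → κ ⊕ (Unit ⊕ μ), Proper φ ∧
        ∀ w, w (Sum.inl ()) = none → ev some φ w ∈ G s) ∨
      (∃ φ : ι → κ ⊕ Fin j, Proper φ ∧ ∀ s w, (∃ q, w q = none) → ev some φ w ∉ G s) := by
  classical
  induction j with
  | zero =>
    intro S _
    refine ⟨Fin 0, inferInstance, fun G => Or.inr ⟨fun i => i.elim0, fun e => e.elim0, ?_⟩⟩
    rintro s w ⟨q, _⟩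
    exact q.elim0
  | succ j ih =>
    intro S _
    obtain ⟨ι', _, h'⟩ := ih (S × κ)
    obtain ⟨ι'', _, h''⟩ := Combinatorics.Subspace.exists_mono_in_high_dimension
      (Option κ) (Set S) (ι' ⊕ μ)
    let a0 : κ := Classical.arbitrary κ
    refine ⟨Unit ⊕ ι'', inferInstance, fun G => ?_⟩
    obtain ⟨ψ, c, hc⟩ := h'' (fun v => {s | Sum.elim (fun _ => none) v ∈ G s})
    let φ : Unit ⊕ ι'' → κ ⊕ (Unit ⊕ (ι' ⊕ μ)) := Sum.elim (fun _ => Sum.inr (Sum.inl ()))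
      (fun i => Sum.elim (fun o => Option.elim o (Sum.inr (Sum.inl ())) Sum.inl)
        (fun e => Sum.inr (Sum.inr e)) (ψ.idxFun i))
    have hφ : Proper φ := by
      rintro (⟨⟩ | e)
      · exact ⟨Sum.inl (), rfl⟩
      · obtain ⟨i, hi⟩ := ψ.proper e
        exact ⟨Sum.inr i, by simp [φ, hi]⟩
    have hF : ∀ w : Unit ⊕ (ι' ⊕ μ) → Option κ, w (Sum.inl ()) = none →
        ev some φ w = Sum.elim (fun _ => none) (ψ (w ∘ Sum.inr)) := by
      intro w hw
      funext q
      rcases q with ⟨⟩ | i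
      · simp [ev, φ, hw]
      · simp only [ev, φ, Sum.elim_inr, Combinatorics.Subspace.coe_apply]
        rcases ψ.idxFun i with (_ | a) | e <;> simp [hw]
    have hcol : ∀ w : Unit ⊕ (ι' ⊕ μ) → Option κ, w (Sum.inl ()) = none →
        ∀ s, ev some φ w ∈ G s ↔ s ∈ c := by
      intro w hw s
      rw [hF w hw, ← hc (w ∘ Sum.inr)]
      rfl
    by_cases hs : ∃ s, s ∈ c
    · obtain ⟨s, hs⟩ := hs
      left
      let χ : Unit ⊕ (ι' ⊕ μ) → κ ⊕ (Unit ⊕ μ) :=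
        Sum.elim (fun _ => Sum.inr (Sum.inl ()))
          (Sum.elim (fun _ => Sum.inl a0) (fun m => Sum.inr (Sum.inr m)))
      have hχ : Proper χ := by
        rintro (⟨⟩ | m)
        · exact ⟨Sum.inl (), rfl⟩
        · exact ⟨Sum.inr (Sum.inr m), rfl⟩
      refine ⟨s, comp φ χ, hφ.comp hχ, fun w hw => ?_⟩
      rw [ev_comp, hcol _ _ s]
      · exact hs
      · simp [ev, χ, hw]
    · push Not at hs
      let χ : κ → Unit ⊕ (ι' ⊕ μ) → κ ⊕ ι' := fun a =>
        Sum.elim (fun _ => Sum.inl a) (Sum.elim Sum.inr (fun _ => Sum.inl a0))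
      have hχ : ∀ a, Proper (χ a) := fun a e => ⟨Sum.inr (Sum.inl e), rfl⟩
      rcases h' (fun p => {y | ev some φ (ev some (χ p.2) y) ∈ G p.1}) with h1 | h2
      · left
        obtain ⟨⟨s, a⟩, φ', hφ', h1⟩ := h1
        refine ⟨s, comp (comp φ (χ a)) φ', (hφ.comp (hχ a)).comp hφ', fun w hw => ?_⟩
        rw [ev_comp, ev_comp]
        exact h1 w hw
      · right
        obtain ⟨φ', hφ', h2⟩ := h2
        let ξ : Unit ⊕ (ι' ⊕ μ) → κ ⊕ Fin (j + 1) :=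
          Sum.elim (fun _ => Sum.inr 0)
            (Sum.elim (fun q => (φ' q).map id Fin.succ) (fun _ => Sum.inl a0))
        have hξ : Proper ξ := by
          intro e
          refine Fin.cases ?_ (fun e => ?_) e
          · exact ⟨Sum.inl (), rfl⟩
          · obtain ⟨i, hi⟩ := hφ' e
            exact ⟨Sum.inr (Sum.inl i), by simp [ξ, hi]⟩
        refine ⟨comp φ ξ, hφ.comp hξ, ?_⟩
        rintro s w ⟨q, hq⟩
        rw [ev_comp]
        rcases hw0 : w 0 with _ | a
        · rw [hcol _ _ s]
          · exact hs s
          · simp [ev, ξ, hw0]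
        · have hq' : ∃ q : Fin j, w q.succ = none := by
            revert hq
            refine Fin.cases ?_ (fun q => ?_) q
            · intro h; simp [hw0] at h
            · intro h; exact ⟨q, h⟩
          have h3 := h2 (s, a) (fun q => w q.succ) hq'
          simp only [Set.mem_ofPred_eq] at h3
          suffices hh : ev some ξ w = ev some (χ a) (ev some φ' (fun q => w q.succ)) by
            rw [hh]; exact h3
          funext q
          rcases q with ⟨⟩ | q | m
          · simp [ev, ξ, χ, hw0]
          · simp only [ev, ξ, χ, Sum.elim_inr, Sum.elim_inl]
            rcases φ' q with b | e <;> simp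
          · simp [ev, ξ, χ]

/-- replace the letter `none` by `some i` -/
def rep {κ ι : Type} (i : κ) (x : ι → Option κ) : ι → Option κ := fun q => some ((x q).getD i)

/-- insensitivity -/
def Ins {κ ι : Type} (i : κ) (D : Set (ι → Option κ)) : Prop := ∀ x, x ∈ D ↔ rep i x ∈ D

section ins
variable {κ ι ι' η : Type}

lemma rep_rep (i : κ) (x : ι → Option κ) : rep i (rep i x) = rep i x := by
  funext q; simp [rep]

lemma rep_ev (i : κ) (φ : ι → Option κ ⊕ η) (x : η → Option κ) :
    rep i (ev id φ (rep i x)) = rep i (ev id φ x) := by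
  funext q
  simp only [rep, ev]
  rcases φ q with a | e <;> simp [rep]

lemma Ins.preimage {i : κ} {D : Set (ι → Option κ)} (h : Ins i D) (φ : ι → Option κ ⊕ η) :
    Ins i {x | ev id φ x ∈ D} := by
  intro x
  simp only [Set.mem_ofPred_eq]
  rw [h, h (ev id φ (rep i x)), rep_ev]

lemma Ins.compl {i : κ} {D : Set (ι → Option κ)} (h : Ins i D) : Ins i Dᶜ := by
  intro x
  simp only [Set.mem_compl_iff]
  rw [h x]

lemma Ins.univ {i : κ} : Ins i (Set.univ : Set (ι → Option κ)) := by intro x; simp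

lemma Ins.right {i : κ} {D : Set (ι ⊕ ι' → Option κ)} (h : Ins i D) (x : ι → Option κ)
    (y : ι' → Option κ) : Sum.elim x (rep i y) ∈ D ↔ Sum.elim x y ∈ D := by
  rw [h, h (Sum.elim x y)]
  have : rep i (Sum.elim x (rep i y)) = rep i (Sum.elim x y) := by
    funext q; rcases q with a | b <;> simp [rep]
  rw [this]

lemma Ins.left {i : κ} {D : Set (ι ⊕ ι' → Option κ)} (h : Ins i D) (x : ι → Option κ)
    (y : ι' → Option κ) : Sum.elim (rep i x) y ∈ D ↔ Sum.elim x y ∈ D := by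
  rw [h, h (Sum.elim x y)]
  have : rep i (Sum.elim (rep i x) y) = rep i (Sum.elim x y) := by
    funext q; rcases q with a | b <;> simp [rep]
  rw [this]

end ins

/-- words with few non-`none` letters are rare -/
lemma few {κ : Type} [Finite κ] [Nonempty κ] (N : ℕ) {ε : ℝ} (hε : 0 < ε) :
    ∃ M : ℕ, dens {x : Fin M → Option κ | Nat.card {q // x q ≠ none} < N} ≤ ε := by
  classical
  have := Fintype.ofFinite κ
  set k : ℝ := (Fintype.card κ : ℝ) with hk
  have hk1 : 0 < k := by rw [hk]; exact_mod_cast Fintype.card_pos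
  set r : ℝ := (1 + k / 2) / (k + 1) with hr
  have hr0 : 0 ≤ r := by positivity
  have hr1 : r < 1 := by rw [hr, div_lt_one (by positivity)]; linarith
  obtain ⟨M, hM⟩ := exists_pow_lt_of_lt_one (show 0 < ε / 2 ^ N by positivity) hr1
  refine ⟨M, ?_⟩
  let h : Option κ → ℝ := fun o => Option.elim o 1 (fun _ => 1 / 2)
  have hsum : ∑ o, h o = 1 + k / 2 := by
    rw [Fintype.sum_option]; simp [h, hk]; ring
  have hle : ∀ x : Fin M → Option κ,
      ind {x : Fin M → Option κ | Nat.card {q // x q ≠ none} < N} x ≤ 2 ^ N * ∏ q, h (x q) := by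
    intro x
    have hprod : ∏ q, h (x q) = (1 / 2) ^ (Nat.card {q // x q ≠ none}) := by
      have : ∀ q, h (x q) = if x q ≠ none then 1 / 2 else 1 := by
        intro q; rcases x q with _ | a <;> simp [h]
      simp only [this]
      rw [Finset.prod_ite]
      simp [Nat.card_eq_fintype_card, Fintype.card_subtype]
    have hnn : 0 ≤ 2 ^ N * ∏ q, h (x q) := by rw [hprod]; positivity
    by_cases hx : x ∈ {x : Fin M → Option κ | Nat.card {q // x q ≠ none} < N}
    · have hx' : Nat.card {q // x q ≠ none} < N := hx
      rw [ind_of_mem hx, hprod]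
      have : (1 / 2 : ℝ) ^ N ≤ (1 / 2) ^ (Nat.card {q // x q ≠ none}) :=
        pow_le_pow_of_le_one (by norm_num) (by norm_num) hx'.le
      calc (1 : ℝ) = 2 ^ N * (1 / 2) ^ N := by rw [← mul_pow]; norm_num
        _ ≤ _ := by gcongr
    · rw [ind_of_notMem hx]; exact hnn
  have h1 : avg (fun x : Fin M → Option κ => ∏ q, h (x q)) = r ^ M := by
    rw [avg_eq, ← Fintype.prod_sum (fun _ : Fin M => h)]
    rw [hsum]
    simp [hr, div_pow, hk]
  calc dens {x : Fin M → Option κ | Nat.card {q // x q ≠ none} < N}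
      ≤ avg (fun x : Fin M → Option κ => 2 ^ N * ∏ q, h (x q)) := avg_mono hle
    _ = 2 ^ N * r ^ M := by rw [avg_const_mul, h1]
    _ ≤ 2 ^ N * (ε / 2 ^ N) := by gcongr
    _ = ε := by field_simp

end USz

namespace USz

/-- overwrite the non-`none` letters -/
def fill {κ ι : Type} (x : ι → Option κ) (z : ι → κ) : ι → Option κ :=
  fun q => (x q).map (fun _ => z q)

lemma avg_fill {κ ι : Type} [Finite κ] [Finite ι] [Nonempty κ] (F : (ι → Option κ) → ℝ) :
    avg F = avg (fun x : ι → Option κ => avg (fun z : ι → κ => F (fill x z))) := by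
  let E : (ι → Option κ) × (ι → κ) → (ι → Option κ) × (ι → κ) :=
    fun p => (fill p.1 p.2, fun q => (p.1 q).getD (p.2 q))
  have hE : Function.Involutive E := by
    rintro ⟨x, z⟩
    refine Prod.ext ?_ ?_
    · funext q; simp only [E, fill]
      rcases x q with _ | a <;> simp
    · funext q; simp only [E, fill]
      rcases x q with _ | a <;> simp
  rw [avg_comm, ← avg_prod (fun (x : ι → Option κ) (z : ι → κ) => F (fill x z))]
  have h1 := avg_equiv hE.toPerm (fun p => F p.1)
  have h2 := avg_prod (fun (x : ι → Option κ) (_ : ι → κ) => F x)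
  rw [avg_const] at h2
  rw [← h2, ← h1]
  rfl

lemma insSub {κ : Type} [Finite κ] [Nonempty κ] (h : DHJ κ) (i : κ) (d : ℕ) {ε : ℝ} (hε : 0 < ε) :
    ∃ M : ℕ, ∀ D : Set (Fin M → Option κ), Ins i D → ε ≤ dens D →
      ∃ φ : Fin M → Option κ ⊕ Fin d, Proper φ ∧ ∀ x, ev id φ x ∈ D := by
  classical
  obtain ⟨N, hN⟩ := h.multi d (ε / 2) (by linarith)
  obtain ⟨M, hM⟩ := few (κ := κ) N (show 0 < ε / 2 by linarith)
  refine ⟨M, fun D hD hd => ?_⟩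
  set W : Set (Fin M → Option κ) := {x | Nat.card {q // x q ≠ none} < N} with hW
  have h1 : ε / 2 ≤ avg (fun x => avg (fun z : Fin M → κ => ind D (fill x z)) - ind W x) := by
    rw [avg_sub, ← avg_fill]
    change ε / 2 ≤ dens D - dens W
    linarith
  obtain ⟨x, hx⟩ := exists_le_of_le_avg h1
  have hle1 : avg (fun z : Fin M → κ => ind D (fill x z)) ≤ 1 := avg_le fun z => ind_le_one _ _
  have hxW : x ∉ W := by
    intro hxW
    rw [ind_of_mem hxW] at hx
    linarith
  rw [ind_of_notMem hxW, sub_zero] at hx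
  have hcard : N ≤ Nat.card {q // x q ≠ none} := not_lt.1 hxW
  have hMD : MD κ (Fin d) {q // x q ≠ none} (ε / 2) := hN.of_card_le (by simpa using hcard)
  rw [avg_split (Equiv.sumCompl (fun q => x q ≠ none))] at hx
  obtain ⟨y, hy⟩ := exists_le_of_le_avg hx
  obtain ⟨φ', hφ', hsub⟩ := hMD {z | fill x (fun q => Sum.elim z y
    ((Equiv.sumCompl (fun q => x q ≠ none)).symm q)) ∈ D} hy
  let φ : Fin M → Option κ ⊕ Fin d := fun q =>
    if hq : x q ≠ none then (φ' ⟨q, hq⟩).map some id else Sum.inl none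
  refine ⟨φ, ?_, fun u => ?_⟩
  · intro e
    obtain ⟨⟨q, hq⟩, hqe⟩ := hφ' e
    exact ⟨q, by simp [φ, hq, hqe]⟩
  · have hp := (hD.preimage φ) u
    simp only [Set.mem_ofPred_eq] at hp
    rw [hp]
    have := hsub (fun e => (u e).getD i)
    simp only [Set.mem_ofPred_eq] at this
    convert this using 1
    funext q
    by_cases hq : x q ≠ none
    · rw [fill, Equiv.sumCompl_symm_apply_of_pos (p := fun q => x q ≠ none) hq]
      obtain ⟨b, hb⟩ := Option.ne_none_iff_exists'.1 hq
      simp only [ev, φ, dif_pos hq, hb, Sum.elim_inl, Option.map_some]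
      rcases φ' ⟨q, hq⟩ with a | e <;> simp [rep]
    · have : x q = none := not_not.1 hq
      simp [ev, φ, fill, this]

/-- all `d`-dimensional averages of `g` are nonpositive -/
def Bdd {α ι : Type} [Finite α] (d : ℕ) (g : (ι → α) → ℝ) : Prop :=
  ∀ φ : ι → α ⊕ Fin d, Proper φ → avg (fun x => g (ev id φ x)) ≤ 0

/-- structured sets do not correlate with `g` -/
def Cl (κ ι : Type) [Finite κ] [Finite ι] (d : ℕ) (ε : ℝ) (s : Finset κ) : Prop :=
  ∀ g : (ι → Option κ) → ℝ, (∀ x, g x ≤ 1) → Bdd d g →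
    ∀ D : κ → Set (ι → Option κ), (∀ i, Ins i (D i)) →
      avg (fun x => ind (⋂ i ∈ s, D i) x * g x) ≤ ε

lemma Bdd.slice {α ι ι' ρ : Type} [Finite α] {d : ℕ} {g : (ι' → α) → ℝ} (hg : Bdd d g)
    (e : ι ⊕ ρ ≃ ι') (y : ρ → α) : Bdd d (fun x : ι → α => g (fun q => Sum.elim x y (e.symm q))) := by
  intro φ hφ
  obtain ⟨ψ, hψ, h⟩ := exists_slice e φ hφ y
  have := hg ψ hψ
  simp only [h] at this
  exact this

lemma Cl.of_equiv_sum {κ ι ι' ρ : Type} [Finite κ] [Finite ι] [Finite ι'] [Finite ρ]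
    (e : ι ⊕ ρ ≃ ι') {d : ℕ} {ε : ℝ} {s : Finset κ} (h : Cl κ ι d ε s) : Cl κ ι' d ε s := by
  intro g hg hb D hD
  rw [avg_split e]
  refine avg_le fun y => ?_
  have := h (fun x : ι → Option κ => g (fun q => Sum.elim x y (e.symm q))) (fun x => hg _)
    (hb.slice e y) (fun i => {x | (fun q => Sum.elim x y (e.symm q)) ∈ D i}) ?_
  · refine le_trans (le_of_eq ?_) this
    congr 1
    funext x
    congr 1
    apply ind_congr
    simp
  · intro i x
    simp only [Set.mem_ofPred_eq]
    rw [hD i, hD i (fun q => Sum.elim (rep i x) y (e.symm q))]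
    have : rep i (fun q => Sum.elim (rep i x) y (e.symm q)) =
        rep i (fun q => Sum.elim x y (e.symm q)) := by
      funext q
      simp only [rep]
      rcases e.symm q with a | b <;> simp [rep]
    rw [this]

lemma Cl.of_card_le {κ ι ι' : Type} [Finite κ] [Finite ι] [Finite ι']
    (hc : Nat.card ι ≤ Nat.card ι') {d : ℕ} {ε : ℝ} {s : Finset κ} (h : Cl κ ι d ε s) :
    Cl κ ι' d ε s := by
  obtain ⟨ρ, _, ⟨e⟩⟩ := exists_equiv_sum hc
  exact h.of_equiv_sum e

lemma claim_aux {κ : Type} [Finite κ] [Nonempty κ] (h : DHJ κ) (i : κ) (d : ℕ) {ε : ℝ}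
    (hε : 0 < ε) : ∃ ρ : ℝ, 0 ≤ ρ ∧ ρ < 1 ∧ ∀ s : ℕ, ∃ (ι : Type) (_ : Finite ι),
      ∀ g : (ι → Option κ) → ℝ, (∀ x, g x ≤ 1) → Bdd d g →
        ∀ D : Set (ι → Option κ), Ins i D →
          avg (fun x => ind D x * g x) ≤ ε + ρ ^ s * (dens D - ε) := by
  classical
  obtain ⟨M, hM⟩ := insSub h i d hε
  set C : ℝ := (Nat.card (Fin M → Option κ) : ℝ) with hC
  have hC1 : 1 ≤ C := by rw [hC]; exact_mod_cast Nat.card_pos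
  have hc0 : 0 < 1 / C := by positivity
  have hc1 : 1 / C ≤ 1 := by rw [div_le_one (by positivity)]; exact hC1
  have hU : ∀ E : Set (Fin M → Option κ), ∃ U : Set (Fin M → Option κ), U ⊆ E ∧
      (Ins i E → 1 / C * (dens E - ε) ≤ dens U) ∧
      (U = ∅ ∨ ∃ φ : Fin M → Option κ ⊕ Fin d, Proper φ ∧ U = Set.range (ev id φ)) := by
    intro E
    by_cases hE : Ins i E ∧ ε ≤ dens E
    · obtain ⟨φ, hφ, hs⟩ := hM E hE.1 hE.2
      refine ⟨Set.range (ev id φ), ?_, fun _ => ?_, Or.inr ⟨φ, hφ, rfl⟩⟩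
      · rintro _ ⟨x, rfl⟩; exact hs x
      · have h1 := avg_ind_range (ev_injective id hφ) (fun _ => 1)
        simp only [mul_one, avg_const, one_mul] at h1
        have h2 : (1 : ℝ) ≤ Nat.card (Fin d → Option κ) := by exact_mod_cast Nat.card_pos
        rw [← h1] at h2
        have h3 : 1 / C ≤ dens (Set.range (ev id φ)) := by
          rw [div_le_iff₀ (by positivity)]; exact h2
        have h4 := dens_le_one E
        refine le_trans ?_ h3
        exact mul_le_of_le_one_right hc0.le (by linarith)
    · refine ⟨∅, Set.empty_subset _, fun hI => ?_, Or.inl rfl⟩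
      have h5 : dens E < ε := by
        by_contra hn; exact hE ⟨hI, not_lt.1 hn⟩
      refine le_trans ?_ (dens_nonneg _)
      exact mul_nonpos_of_nonneg_of_nonpos hc0.le (by linarith)
  choose U hUE hUd hUr using hU
  refine ⟨1 - 1 / C, by linarith, by linarith, fun s => ?_⟩
  induction s with
  | zero =>
    refine ⟨Fin 0, inferInstance, fun g hg _ D _ => ?_⟩
    rw [pow_zero, one_mul, add_sub_cancel]
    refine avg_mono fun x => ?_
    exact mul_le_of_le_one_right (ind_nonneg _ _) (hg x)
  | succ s ih =>
    obtain ⟨ι, _, hι⟩ := ih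
    refine ⟨Fin M ⊕ ι, inferInstance, fun g hg hb D hD => ?_⟩
    let E : (ι → Option κ) → Set (Fin M → Option κ) := fun y => {x | Sum.elim x y ∈ D}
    have hEI : ∀ y, Ins i (E y) := fun y x => (hD.left x y).symm
    have hErep : ∀ y, E (rep i y) = E y := fun y => by
      ext x; exact hD.right x y
    let D1 : Set (Fin M ⊕ ι → Option κ) := {p | p ∘ Sum.inl ∈ U (E (p ∘ Sum.inr))}
    have hD1 : ∀ x y, Sum.elim x y ∈ D1 ↔ x ∈ U (E y) := fun x y => Iff.rfl
    have hsub : D1 ⊆ D := by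
      intro p hp
      have := hUE _ hp
      simp only [E, Set.mem_ofPred_eq] at this
      rwa [Sum.elim_comp_inl_inr] at this
    let D2 := D \ D1
    have hsplit : ∀ p, ind D p = ind D1 p + ind D2 p := by
      intro p
      by_cases h1 : p ∈ D1
      · have h2 : p ∉ D2 := fun h => h.2 h1
        rw [ind_of_mem (hsub h1), ind_of_mem h1, ind_of_notMem h2]; norm_num
      · rw [ind_of_notMem h1, zero_add]
        exact ind_congr ⟨fun h => ⟨h, h1⟩, fun h => h.1⟩
    have e1 : avg (fun p => ind D1 p * g p) ≤ 0 := by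
      rw [avg_sumElim]
      refine avg_le fun y => ?_
      have : ∀ x, ind D1 (Sum.elim x y) = ind (U (E y)) x := fun x => ind_congr (hD1 x y)
      simp only [this]
      rcases hUr (E y) with h0 | ⟨φ, hφ, hr⟩
      · rw [h0]; simp [ind, avg]
      · rw [hr]
        have h1 := avg_ind_range (ev_injective id hφ) (fun x => g (Sum.elim x y))
        have h2 := (hb.slice (Equiv.refl _) y) φ hφ
        simp only [Equiv.refl_symm, Equiv.refl_apply] at h2
        have h3 : avg (fun x => ind (Set.range (ev id φ)) x * g (Sum.elim x y)) * C ≤ 0 := by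
          rw [hC, h1]
          exact mul_nonpos_of_nonpos_of_nonneg h2 (by positivity)
        by_contra hn
        push Not at hn
        have : 0 < avg (fun x => ind (Set.range (ev id φ)) x * g (Sum.elim x y)) * C := by
          positivity
        linarith
    have hdens2 : dens D2 = avg (fun x : Fin M → Option κ => dens {y : ι → Option κ |
        Sum.elim x y ∈ D2}) := by
      rw [dens, avg_sumElim']; rfl
    have e2 : avg (fun p => ind D2 p * g p) ≤ ε + (1 - 1 / C) ^ s * (dens D2 - ε) := by
      rw [avg_sumElim']
      have hx : ∀ x : Fin M → Option κ,
          avg (fun y : ι → Option κ => ind D2 (Sum.elim x y) * g (Sum.elim x y)) ≤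
          ε + (1 - 1 / C) ^ s * (dens {y : ι → Option κ | Sum.elim x y ∈ D2} - ε) := by
        intro x
        refine hι (fun y => g (Sum.elim x y)) (fun y => hg _) ?_ {y | Sum.elim x y ∈ D2} ?_
        · have := hb.slice (Equiv.sumComm ι (Fin M)) x
          convert this using 3 with y
          funext q
          rcases q with a | b <;> simp
        · intro y
          change (Sum.elim x y ∈ D ∧ ¬ Sum.elim x y ∈ D1) ↔
            (Sum.elim x (rep i y) ∈ D ∧ ¬ Sum.elim x (rep i y) ∈ D1)
          rw [hD1, hD1, hErep, hD.right]
      refine (avg_mono hx).trans (le_of_eq ?_)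
      rw [avg_add, avg_const, avg_const_mul, avg_sub, avg_const, hdens2]
    have e3 : dens D = dens D1 + dens D2 := by
      rw [dens, dens, dens, ← avg_add]
      congr 1; funext p; exact hsplit p
    have e4 : 1 / C * (dens D - ε) ≤ dens D1 := by
      have h1 : dens D1 = avg (fun y => dens (U (E y))) := by
        rw [dens, avg_sumElim]; rfl
      have h2 : dens D = avg (fun y => dens (E y)) := by
        rw [dens, avg_sumElim]; rfl
      rw [h1, h2]
      have := avg_mono (fun y => hUd (E y) (hEI y))
      rw [avg_const_mul, avg_sub, avg_const] at this
      exact this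
    have e5 : avg (fun p => ind D p * g p) =
        avg (fun p => ind D1 p * g p) + avg (fun p => ind D2 p * g p) := by
      rw [← avg_add]; congr 1; funext p; rw [hsplit]; ring
    have hρ : 0 ≤ (1 - 1 / C) ^ s := pow_nonneg (by linarith) _
    have e6 : (1 - 1 / C) ^ s * (dens D2 - ε) ≤ (1 - 1 / C) ^ s * ((1 - 1 / C) * (dens D - ε)) :=
      mul_le_mul_of_nonneg_left (by linarith) hρ
    rw [e5, pow_succ, mul_assoc]
    linarith

lemma claim_all {κ : Type} [Finite κ] [Nonempty κ] (h : DHJ κ) (s : Finset κ) :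
    ∀ (d : ℕ) (ε : ℝ), 0 < ε → ∃ n : ℕ, Cl κ (Fin n) d ε s := by
  classical
  induction s using Finset.induction_on with
  | empty =>
    intro d ε hε
    refine ⟨d, fun g hg hb D hD => ?_⟩
    have := hb (fun i => Sum.inr i) (fun e => ⟨e, rfl⟩)
    refine le_trans (le_of_eq ?_) (this.trans hε.le)
    congr 1; funext x
    simp [ind]
    rfl
  | insert a s ha ih =>
    intro d ε hε
    obtain ⟨ρ, hρ0, hρ1, hr⟩ := claim_aux h a d (show 0 < ε / 4 by linarith)
    obtain ⟨t, ht⟩ := exists_pow_lt_of_lt_one (show 0 < ε / 4 by linarith) hρ1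
    obtain ⟨ι, _, hι⟩ := hr t
    have h1 : Cl κ ι d (ε / 2) {a} := by
      intro g hg hb D hD
      have := hι g hg hb (D a) (hD a)
      have hset : (⋂ i ∈ ({a} : Finset κ), D i) = D a := by simp
      rw [hset]
      have h2 : ρ ^ t * (dens (D a) - ε / 4) ≤ ρ ^ t * 1 := by
        apply mul_le_mul_of_nonneg_left _ (pow_nonneg hρ0 _)
        have := dens_le_one (D a)
        linarith
      linarith
    have h1' : Cl κ (Fin (Nat.card ι)) d (ε / 2) {a} := h1.of_card_le (by simp)
    obtain ⟨n, hn⟩ := ih (Nat.card ι) (ε / 2) (by linarith)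
    refine ⟨n, fun g hg hb D hD => ?_⟩
    have key := hn (fun x => ind (D a) x * g x - ε / 2) ?_ ?_ D hD
    · have e : ∀ x, ind (⋂ i ∈ insert a s, D i) x * g x =
          ind (⋂ i ∈ s, D i) x * (ind (D a) x * g x - ε / 2) + ε / 2 * ind (⋂ i ∈ s, D i) x := by
        intro x
        rw [Finset.set_biInter_insert, ind_inter]; ring
      simp only [e]
      rw [avg_add, avg_const_mul]
      have h3 := dens_le_one (⋂ i ∈ s, D i)
      have h4 : ε / 2 * avg (ind (⋂ i ∈ s, D i)) ≤ ε / 2 * 1 :=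
        mul_le_mul_of_nonneg_left h3 (by linarith)
      linarith
    · intro x
      have h5 : ind (D a) x * g x ≤ 1 := by
        have := mul_le_of_le_one_right (ind_nonneg (D a) x) (hg x)
        have := ind_le_one (D a) x
        linarith
      change ind (D a) x * g x - ε / 2 ≤ 1
      linarith
    · intro φ hφ
      rw [avg_sub, avg_const]
      have := h1' (fun x => g (ev id φ x)) (fun x => hg _) ?_ (fun i => {x | ev id φ x ∈ D i})
        (fun i => (hD i).preimage φ)
      · have hset : (⋂ i ∈ ({a} : Finset κ), {x | ev id φ x ∈ D i}) = {x | ev id φ x ∈ D a} := by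
          simp
        rw [hset] at this
        have h6 : avg (fun x => ind {x | ev id φ x ∈ D a} x * g (ev id φ x)) =
          avg (fun x => ind (D a) (ev id φ x) * g (ev id φ x)) := rfl
        linarith
      · intro ψ hψ
        have := hb (comp φ ψ) (hφ.comp hψ)
        simp only [ev_comp] at this
        exact this

/-- the form used below -/
lemma claim_compl {κ ι : Type} [Finite κ] [Finite ι] {d : ℕ} {ε : ℝ}
    [Fintype κ] (h : Cl κ ι d ε Finset.univ) (g : (ι → Option κ) → ℝ) (hg : ∀ x, g x ≤ 1)
    (hb : Bdd d g) (D : κ → Set (ι → Option κ)) (hD : ∀ i, Ins i (D i)) (s : Finset κ) :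
    avg (fun x => (1 - ind (⋂ i ∈ s, D i) x) * g x) ≤ s.card * ε := by
  classical
  induction s using Finset.induction_on with
  | empty => simp [ind, avg]
  | insert a s ha ih =>
    let D' : κ → Set (ι → Option κ) := fun i => if i = a then (D a)ᶜ else if i ∈ s then D i else Set.univ
    have hD' : ∀ i, Ins i (D' i) := by
      intro i
      by_cases h1 : i = a
      · subst h1; simp only [D', if_true]; exact (hD i).compl
      · by_cases h2 : i ∈ s
        · simp only [D', h1, h2, if_true, if_false]; exact hD i
        · simp only [D', h1, h2, if_false]; exact Ins.univ
    have h1 := h g hg hb D' hD'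
    have hset : (⋂ i ∈ (Finset.univ : Finset κ), D' i) = (D a)ᶜ ∩ ⋂ i ∈ s, D i := by
      ext x
      simp only [Finset.mem_univ, Set.iInter_true, Set.mem_iInter, Set.mem_inter_iff]
      constructor
      · intro hx
        refine ⟨by simpa [D'] using hx a, fun i hi => ?_⟩
        have hia : i ≠ a := fun hh => ha (hh ▸ hi)
        simpa [D', hia, hi] using hx i
      · rintro ⟨hx1, hx2⟩ i
        by_cases h1 : i = a
        · subst h1; simpa [D'] using hx1
        · by_cases h2 : i ∈ s
          · simpa [D', h1, h2] using hx2 i h2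
          · simp [D', h1, h2]
    rw [hset] at h1
    have e : ∀ x, (1 - ind (⋂ i ∈ insert a s, D i) x) * g x =
        (1 - ind (⋂ i ∈ s, D i) x) * g x + ind ((D a)ᶜ ∩ ⋂ i ∈ s, D i) x * g x := by
      intro x
      rw [Finset.set_biInter_insert, ind_inter, ind_inter, ind_compl]; ring
    simp only [e]
    rw [avg_add, Finset.card_insert_of_notMem ha]
    push_cast
    linarith

end USz

namespace USz

lemma dens_noNone {κ ι : Type} [Finite κ] [Finite ι] :
    dens {x : ι → Option κ | ∀ q, x q ≠ none} =
      ((Nat.card κ : ℝ) / (Nat.card κ + 1)) ^ Nat.card ι := by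
  classical
  have := Fintype.ofFinite κ
  have := Fintype.ofFinite ι
  let h : Option κ → ℝ := fun o => Option.elim o 0 (fun _ => 1)
  have hsum : ∑ o, h o = Nat.card κ := by
    rw [Fintype.sum_option]; simp [h]
  have he : ∀ x : ι → Option κ, ind {x : ι → Option κ | ∀ q, x q ≠ none} x = ∏ q, h (x q) := by
    intro x
    by_cases hx : x ∈ {x : ι → Option κ | ∀ q, x q ≠ none}
    · rw [ind_of_mem hx, Finset.prod_eq_one]
      intro q _
      obtain ⟨a, ha⟩ := Option.ne_none_iff_exists'.1 (hx q)
      simp [h, ha]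
    · rw [ind_of_notMem hx]
      have : ∃ q, x q = none := by
        by_contra hn; push Not at hn; exact hx hn
      obtain ⟨q, hq⟩ := this
      symm
      apply Finset.prod_eq_zero (Finset.mem_univ q)
      simp [h, hq]
  rw [dens]
  simp only [funext he]
  rw [avg_eq, ← Fintype.prod_sum (fun _ : ι => h), hsum]
  simp [div_pow]

lemma dens_first {κ μ : Type} [Finite κ] [Finite μ] :
    dens {x : Unit ⊕ μ → Option κ | x (Sum.inl ()) = none} = 1 / ((Nat.card κ : ℝ) + 1) := by
  classical
  have := Fintype.ofFinite κ
  have e1 : ∀ (x : Unit → Option κ) (y : μ → Option κ),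
      ind {x : Unit ⊕ μ → Option κ | x (Sum.inl ()) = none} (Sum.elim x y) =
        ind {(none : Option κ)} (x ()) := by
    intro x y
    apply ind_congr
    simp
  rw [dens, avg_sumElim']
  simp only [e1, avg_const]
  have := avg_equiv (Equiv.funUnique Unit (Option κ)) (ind {(none : Option κ)})
  refine Eq.trans this ?_
  rw [avg_eq]
  have : ∀ o : Option κ, ind {(none : Option κ)} o = if o = none then 1 else 0 := by
    intro o; simp [ind, Set.indicator_apply]
  simp [this]

lemma avg_lower {X : Type} [Finite X] {f : X → ℝ} {a b : ℝ} (hb : ∀ x, f x ≤ b)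
    (ha : a ≤ avg f) (x0 : X) : b - Nat.card X * (b - a) ≤ f x0 := by
  have := Fintype.ofFinite X
  have : Nonempty X := ⟨x0⟩
  have hc := card_pos' (X := X)
  have h1 : b - f x0 ≤ ∑ x, (b - f x) :=
    Finset.single_le_sum (f := fun x => b - f x) (fun x _ => by linarith [hb x]) (Finset.mem_univ x0)
  have h2 : ∑ x, (b - f x) = Nat.card X * (b - avg f) := by
    rw [avg_eq, Finset.sum_sub_distrib]; simp; field_simp
  have h3 : (Nat.card X : ℝ) * (b - avg f) ≤ Nat.card X * (b - a) := by gcongr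
  linarith

lemma rep_ev_some {κ ι η : Type} (i : κ) (φ : ι → κ ⊕ η) (x : η → Option κ) :
    rep i (ev some φ x) = ev some φ (rep i x) := by
  funext q
  simp only [rep, ev]
  rcases φ q with a | e <;> simp [rep]

lemma inc {κ : Type} [Finite κ] [Nonempty κ] (h : DHJ κ) {δ : ℝ} (hδ : 0 < δ)
    (hP : ∀ γ : ℝ, 0 < γ → DHJat (Option κ) (δ + γ)) :
    ∃ γ : ℝ, 0 < γ ∧ DHJat (Option κ) (δ - γ) := by
  classical
  have := Fintype.ofFinite κ
  set k : ℝ := (Nat.card κ : ℝ) with hk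
  have hk0 : 0 < k := card_pos'
  obtain ⟨j, hj⟩ := h (δ / 4) (by linarith)
  have hK := card_pos' (X := Fin j → κ ⊕ Unit)
  set θ : ℝ := δ / 4 / Nat.card (Fin j → κ ⊕ Unit) with hθ
  have hθ0 : 0 < θ := by positivity
  set σ : ℝ := δ * (θ * (1 / (k + 1))) with hσ
  have hσ0 : 0 < σ := by positivity
  obtain ⟨n0, hn0⟩ := hP (σ / 8) (by linarith)
  set ε : ℝ := σ / 8 / k with hε
  have hε0 : 0 < ε := by positivity
  obtain ⟨nC, hnC⟩ := claim_all h Finset.univ n0 ε hε0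
  have hr1 : k / (k + 1) < 1 := by rw [div_lt_one (by positivity)]; linarith
  obtain ⟨t, ht⟩ := exists_pow_lt_of_lt_one (show 0 < σ / 8 by linarith) hr1
  let X : Type := Unit ⊕ (Fin nC ⊕ Fin t)
  have hClX : Cl κ X n0 ε Finset.univ := hnC.of_card_le (by simp [X]; omega)
  have hτ : dens {x : X → Option κ | ∀ q, x q ≠ none} ≤ σ / 8 := by
    rw [dens_noNone, ← hk]
    refine le_trans (pow_le_pow_of_le_one (by positivity) hr1.le ?_) ht.le
    simp [X]; omega
  obtain ⟨ι1, _, hgood⟩ := good (κ := κ) (Fin nC ⊕ Fin t) j Unit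
  set n1 : ℝ := (Nat.card (ι1 → Option κ) : ℝ) with hn1
  have hn10 : 0 < n1 := card_pos'
  set m : ℝ := min (σ / 8) (δ / 2) with hm
  have hm0 : 0 < m := lt_min (by linarith) (by linarith)
  set γ : ℝ := m / n1 / 2 with hγ
  have hγ0 : 0 < γ := by positivity
  have hγm : n1 * (2 * γ) = m := by rw [hγ]; field_simp
  obtain ⟨n2, hn2⟩ := hP γ hγ0
  refine ⟨γ, hγ0, DHJat.of_type (ι := ι1 ⊕ Fin n2) ?_⟩
  intro A hA
  by_contra hno
  have hsubsp : ∀ (η : Type) [Finite η] (β : ℝ) (φ : ι1 ⊕ Fin n2 → Option κ ⊕ η), Proper φ →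
      MD (Option κ) Unit η β → dens {x | ev id φ x ∈ A} < β := by
    intro η _ β φ hφ hMD
    by_contra hn
    obtain ⟨ψ, hψ, hs⟩ := hMD _ (not_lt.1 hn)
    exact hno ⟨comp φ ψ, hφ.comp hψ, fun x => by rw [ev_comp]; exact hs x⟩
  have hup : ∀ x : ι1 → Option κ, dens {y : Fin n2 → Option κ | Sum.elim x y ∈ A} ≤ δ + γ := by
    intro x
    let φ : ι1 ⊕ Fin n2 → Option κ ⊕ Fin n2 := Sum.elim (fun q => Sum.inl (x q)) Sum.inr
    have := hsubsp _ _ φ (fun e => ⟨Sum.inr e, rfl⟩) hn2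
    have he : ∀ y, ev id φ y = Sum.elim x y := by
      intro y; funext q; rcases q with a | b <;> simp [ev, φ]
    simp only [he] at this
    exact this.le
  have hlow : ∀ x : ι1 → Option κ, δ - m ≤ dens {y : Fin n2 → Option κ | Sum.elim x y ∈ A} := by
    intro x
    have hA' : δ - γ ≤ avg (fun x : ι1 → Option κ =>
        dens {y : Fin n2 → Option κ | Sum.elim x y ∈ A}) := by
      rw [dens, avg_sumElim'] at hA; exact hA
    have := avg_lower hup hA' x
    rw [← hn1] at this
    have h2 : n1 * (δ + γ - (δ - γ)) = m := by rw [← hγm]; ring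
    linarith
  have hmδ : m ≤ δ / 2 := min_le_right _ _
  have hmσ : m ≤ σ / 8 := min_le_left _ _
  rcases hgood (fun _ => {w | θ ≤ dens {y : Fin n2 → Option κ |
      ∀ i, Sum.elim (rep i w) y ∈ A}}) with h1 | h2
  · obtain ⟨-, φ, hφ, hw⟩ := h1
    let Φ : (Fin n2 → Option κ) → ι1 ⊕ Fin n2 → Option κ ⊕ X := fun y =>
      Sum.elim (fun q => (φ q).map some id) (fun p => Sum.inl (y p))
    have hΦ : ∀ y, Proper (Φ y) := by
      intro y e
      obtain ⟨q, hq⟩ := hφ e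
      exact ⟨Sum.inl q, by simp [Φ, hq]⟩
    have hΦev : ∀ y x, ev id (Φ y) x = Sum.elim (ev some φ x) y := by
      intro y x
      funext q
      rcases q with q | q
      · simp only [ev, Φ, Sum.elim_inl]
        rcases φ q with a | e <;> simp
      · simp [ev, Φ]
    let Ay : (Fin n2 → Option κ) → Set (X → Option κ) := fun y => {x | Sum.elim (ev some φ x) y ∈ A}
    let D : (Fin n2 → Option κ) → κ → Set (X → Option κ) := fun y i => {x | rep i x ∈ Ay y}
    let C : (Fin n2 → Option κ) → Set (X → Option κ) := fun y => ⋂ i ∈ Finset.univ, D y i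
    have hD : ∀ y i, Ins i (D y i) := by
      intro y i x
      simp only [D, Set.mem_ofPred_eq, rep_rep]
    have hmemC : ∀ y x, x ∈ C y ↔ ∀ i, Sum.elim (rep i (ev some φ x)) y ∈ A := by
      intro y x
      simp [C, D, Ay, rep_ev_some]
    have hAC : ∀ y x, ind (C y) x * ind (Ay y) x ≤ ind {x : X → Option κ | ∀ q, x q ≠ none} x := by
      intro y x
      rw [← ind_inter]
      apply ind_mono
      rintro x ⟨hxC, hxA⟩ q hq
      apply hno
      let ξ : X → Option κ ⊕ Unit := fun e => Option.elim (x e) (Sum.inr ()) (fun a => Sum.inl (some a))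
      have hξ : Proper ξ := fun _ => ⟨q, by simp [ξ, hq]⟩
      refine ⟨comp (Φ y) ξ, (hΦ y).comp hξ, fun u => ?_⟩
      rw [ev_comp, hΦev]
      rcases hu : u () with _ | i
      · have : ev id ξ u = x := by
          funext e
          simp only [ev, ξ]
          rcases x e with _ | a <;> simp [hu]
        rw [this]; exact hxA
      · have : ev id ξ u = rep i x := by
          funext e
          simp only [ev, ξ, rep]
          rcases x e with _ | a <;> simp [hu]
        rw [this, ← rep_ev_some]
        exact (hmemC y x).1 hxC i
    have hupy : ∀ y, dens (Ay y) ≤ σ / 8 + σ / 8 + (δ + σ / 8) * (1 - dens (C y)) := by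
      intro y
      have h1 := claim_compl hClX (fun x => ind (Ay y) x - (δ + σ / 8))
        (fun x => by have := ind_le_one (Ay y) x; linarith) ?_ (D y) (hD y) Finset.univ
      · have h2 : ((Finset.univ : Finset κ).card : ℝ) * ε = σ / 8 := by
          rw [Finset.card_univ, ← Nat.card_eq_fintype_card, ← hk, hε]; field_simp
        rw [h2] at h1
        have h3 := avg_mono (hAC y)
        have h4 : dens (Ay y) = avg (fun x => ind (C y) x * ind (Ay y) x) +
            (avg (fun x => (1 - ind (C y) x) * (ind (Ay y) x - (δ + σ / 8))) +
              (δ + σ / 8) * (1 - dens (C y))) := by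
          have h5 : (δ + σ / 8) * (1 - dens (C y)) =
              avg (fun x => (δ + σ / 8) * (1 - ind (C y) x)) := by
            rw [avg_const_mul, avg_sub, avg_const]; rfl
          rw [h5, ← avg_add, ← avg_add, dens]
          congr 1; funext x; ring
        rw [h4]
        have h6 : avg (ind {x : X → Option κ | ∀ q, x q ≠ none}) ≤ σ / 8 := hτ
        have h7 : avg (fun x => (1 - ind (C y) x) * (ind (Ay y) x - (δ + σ / 8))) ≤ σ / 8 := h1
        linarith
      · intro ψ hψ
        rw [avg_sub, avg_const]
        have := hsubsp _ _ (comp (Φ y) ψ) ((hΦ y).comp hψ) hn0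
        simp only [ev_comp, hΦev] at this
        have h5 : avg (fun x => ind (Ay y) (ev id ψ x)) =
          dens {x | Sum.elim (ev some φ (ev id ψ x)) y ∈ A} := rfl
        linarith
    have hfin := avg_mono hupy
    rw [avg_add, avg_const, avg_const_mul, avg_sub, avg_const] at hfin
    have hl1 : δ - m ≤ avg (fun y => dens (Ay y)) := by
      have : avg (fun y => dens (Ay y)) = avg (fun x : X → Option κ =>
          dens {y : Fin n2 → Option κ | Sum.elim (ev some φ x) y ∈ A}) := by
        simp only [dens]; rw [avg_comm]; rfl
      rw [this]
      exact le_avg fun x => hlow _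
    have hl2 : θ * (1 / (k + 1)) ≤ avg (fun y => dens (C y)) := by
      have : avg (fun y => dens (C y)) = avg (fun x : X → Option κ =>
          dens {y : Fin n2 → Option κ | ∀ i, Sum.elim (rep i (ev some φ x)) y ∈ A}) := by
        simp only [dens]; rw [avg_comm]
        congr 1; funext x; congr 1; funext y
        exact ind_congr (hmemC y x)
      rw [this, ← dens_first (κ := κ) (μ := Fin nC ⊕ Fin t), dens, ← avg_const_mul]
      refine avg_mono fun x => ?_
      by_cases hx : x ∈ {x : Unit ⊕ (Fin nC ⊕ Fin t) → Option κ | x (Sum.inl ()) = none}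
      · rw [ind_of_mem hx, mul_one]
        exact hw x hx
      · rw [ind_of_notMem hx, mul_zero]
        exact dens_nonneg _
    have h8 : δ * (θ * (1 / (k + 1))) ≤ (δ + σ / 8) * avg (fun y => dens (C y)) := by
      apply mul_le_mul (by linarith) hl2 (by positivity) (by linarith)
    rw [← hσ] at h8
    linarith
  · obtain ⟨φ, hφ, hw⟩ := h2
    let B : (Fin n2 → Option κ) → Set (Fin j → κ) := fun y =>
      {x | Sum.elim (ev some φ (fun q => some (x q))) y ∈ A}
    have hB : 2 * (δ / 4) ≤ avg (fun y => dens (B y)) := by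
      have : avg (fun y => dens (B y)) = avg (fun x : Fin j → κ =>
          dens {y : Fin n2 → Option κ | Sum.elim (ev some φ (fun q => some (x q))) y ∈ A}) := by
        simp only [dens]; rw [avg_comm]; rfl
      rw [this]
      refine le_avg fun x => ?_
      have := hlow (ev some φ (fun q => some (x q)))
      linarith
    obtain ⟨ℓ, hℓ, hd⟩ := popular (by linarith) hj B hB
    let w : Fin j → Option κ := fun q => Sum.elim some (fun _ => none) (ℓ q)
    have hwn : ∃ q, w q = none := by
      obtain ⟨q, hq⟩ := hℓ ()
      exact ⟨q, by simp [w, hq]⟩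
    apply hw () w hwn
    refine hd.trans (le_of_eq ?_)
    congr 1
    ext y
    simp only [Set.mem_ofPred_eq, B]
    refine forall_congr' fun i => ?_
    rw [rep_ev_some]
    have : rep i w = fun q => some (line ℓ i q) := by
      funext q
      simp only [rep, w, line, ev]
      rcases ℓ q with a | e <;> simp
    rw [this]

lemma dhj_step {κ : Type} [Finite κ] [Nonempty κ] (h : DHJ κ) : DHJ (Option κ) := by
  intro δ hδ
  by_contra hn
  have hmono : ∀ a b : ℝ, a ≤ b → DHJat (Option κ) a → DHJat (Option κ) b := by
    rintro a b hab ⟨n, hn⟩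
    exact ⟨n, hn.mono hab⟩
  let S : Set ℝ := {x | DHJat (Option κ) x}
  have h2 : (2 : ℝ) ∈ S := by
    refine ⟨0, fun A hA => ?_⟩
    have := dens_le_one A
    linarith
  have hlb : ∀ x ∈ S, δ ≤ x := by
    intro x hx
    by_contra hc
    exact hn (hmono x δ (by linarith) hx)
  have hbdd : BddBelow S := ⟨δ, hlb⟩
  have h0 : δ ≤ sInf S := le_csInf ⟨2, h2⟩ hlb
  obtain ⟨γ, hγ, hS⟩ := inc h (lt_of_lt_of_le hδ h0) (by
    intro γ hγ
    obtain ⟨x, hx, hlt⟩ := exists_lt_of_csInf_lt ⟨2, h2⟩ (show sInf S < sInf S + γ by linarith)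
    exact hmono x _ hlt.le hx)
  have := csInf_le hbdd hS
  linarith

lemma dhj (k : ℕ) : ∃ (α : Type) (_ : Finite α), Nat.card α = k + 1 ∧ DHJ α := by
  induction k with
  | zero =>
    refine ⟨Unit, inferInstance, by simp, fun δ hδ => ⟨1, fun A hA => ?_⟩⟩
    obtain ⟨x, hx⟩ := exists_le_of_le_avg hA
    have hxA : x ∈ A := by
      by_contra hn
      rw [ind_of_notMem hn] at hx; linarith
    refine ⟨fun _ => Sum.inr (), fun e => ⟨0, rfl⟩, fun z => ?_⟩
    convert hxA
  | succ k ih =>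
    obtain ⟨α, _, hc, h⟩ := ih
    have : Nonempty α := (Nat.card_pos_iff.1 (by omega)).1
    exact ⟨Option α, inferInstance, by simp [Finite.card_option, hc], dhj_step h⟩

end USz

namespace USz

lemma ncard_div_eq {Γ : Type} (A : Set Γ) (P : Finset Γ) :
    ((A ∩ (P : Set Γ)).ncard : ℝ) / P.card = dens {x : P | (x : Γ) ∈ A} := by
  classical
  unfold dens
  rw [avg_eq]
  have h1 : A ∩ (P : Set Γ) = ((P.filter (fun x => x ∈ A) : Finset Γ) : Set Γ) := by
    ext x; simp [and_comm]
  rw [h1, Set.ncard_coe_finset]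
  congr 1
  · rw [Finset.card_filter]
    push_cast
    rw [← Finset.sum_coe_sort]
    refine Finset.sum_congr rfl fun x _ => ?_
    by_cases hx : x ∈ {x : P | (x : Γ) ∈ A}
    · rw [ind_of_mem hx]; exact if_pos hx
    · rw [ind_of_notMem hx]; exact if_neg hx
  · simp

lemma core {Γ α : Type} [AddCommGroup Γ] [Finite α] {δ : ℝ} (hδ : 0 < δ) {n : ℕ}
    (h : MD α Unit (Fin n) δ) (m : α → ℤ) (B : Set Γ) (P Q : Finset Γ)
    (hP : P.Nonempty) (hQ : Q.Nonempty)
    (hB : ∀ (w : Fin n → α) (d : Fin n → Q),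
      2 * δ ≤ dens {x : P | (x : Γ) + ∑ i, m (w i) • (d i : Γ) ∈ B}) [Nonempty α] :
    ∃ u v : Γ, δ / Nat.card (Fin n → α ⊕ Unit) ≤
      dens {p : P × Q | ∀ a, ((p.1 : Γ) + u) + m a • ((p.2 : Γ) + v) ∈ B} := by
  classical
  have : Nonempty P := hP.to_subtype
  have : Nonempty Q := hQ.to_subtype
  let S : P × (Fin n → Q) → Set (Fin n → α) := fun y =>
    {w | (y.1 : Γ) + ∑ i, m (w i) • (y.2 i : Γ) ∈ B}
  have hS : 2 * δ ≤ avg fun y => dens (S y) := by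
    unfold dens
    rw [avg_comm]
    refine le_avg fun w => ?_
    rw [avg_prod (fun x d => ind (S (x, d)) w)]
    refine le_avg fun d => ?_
    refine (hB w d).trans (le_of_eq ?_)
    unfold dens
    congr 1
  obtain ⟨ℓ, hℓ, hd⟩ := popular hδ h S hS
  obtain ⟨i0, hi0⟩ := hℓ ()
  let e := Equiv.funSplitAt i0 Q
  have h2 : dens {y | ∀ a, line ℓ a ∈ S y} =
      avg fun r : ({j // j ≠ i0} → Q) => avg fun t : Q => avg fun x : P =>
        ind {y | ∀ a, line ℓ a ∈ S y} (x, e.symm (t, r)) := by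
    unfold dens
    rw [avg_prod (fun x d => ind {y | ∀ a, line ℓ a ∈ S y} (x, d)), ← avg_equiv e.symm]
    rw [← avg_prod (fun (t : Q) (r : {j // j ≠ i0} → Q) => avg fun x : P =>
        ind {y | ∀ a, line ℓ a ∈ S y} (x, e.symm (t, r)))]
  rw [h2] at hd
  obtain ⟨r, hr⟩ := exists_le_of_le_avg hd
  let r' : Fin n → Γ := fun i => if hi : i = i0 then 0 else (r ⟨i, hi⟩ : Γ)
  refine ⟨∑ i, Sum.elim (fun c => m c • r' i) (fun _ => 0) (ℓ i),
    ∑ i, Sum.elim (fun _ => 0) (fun _ => r' i) (ℓ i), hr.trans (le_of_eq ?_)⟩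
  unfold dens
  rw [← avg_prod (fun (x : P) (t : Q) => ind {y | ∀ a, line ℓ a ∈ S y} (x, e.symm (t, r)))]
  congr 1
  ext ⟨x, t⟩
  apply ind_congr
  simp only [Set.mem_ofPred_eq, S]
  refine forall_congr' fun a => ?_
  have key : ∑ i, m (line ℓ a i) • ((e.symm (t, r) i : Q) : Γ) =
      ∑ i, Sum.elim (fun c => m c • r' i) (fun _ => 0) (ℓ i) +
      m a • ((t : Γ) + ∑ i, Sum.elim (fun _ => 0) (fun _ => r' i) (ℓ i)) := by
    have ht : (t : Γ) = ∑ i, if i = i0 then (t : Γ) else 0 := by simp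
    conv_rhs => rw [ht]
    rw [← Finset.sum_add_distrib, Finset.smul_sum, ← Finset.sum_add_distrib]
    refine Finset.sum_congr rfl fun i _ => ?_
    by_cases hi : i = i0
    · subst hi
      simp [line, ev, hi0, e, r', Equiv.funSplitAt, Equiv.piSplitAt]
    · rcases hl : ℓ i with c | c
      · simp [line, ev, hl, e, r', hi, Equiv.funSplitAt, Equiv.piSplitAt]
      · simp [line, ev, hl, e, r', hi, Equiv.funSplitAt, Equiv.piSplitAt]
  rw [key, add_assoc]

lemma dens_shift {Γ : Type} [AddCommGroup Γ] (B : Set Γ) (P : Finset Γ) (hP : P.Nonempty) (σ : Γ)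
    {ε η : ℝ} (h1 : η ≤ ((B ∩ (P : Set Γ)).ncard : ℝ) / P.card)
    (h2 : 1 - ε ≤ (((P : Set Γ) ∩ ((· + σ) '' (P : Set Γ))).ncard : ℝ) / P.card) :
    η - ε ≤ dens {x : P | (x : Γ) + σ ∈ B} := by
  classical
  have hc : (0 : ℝ) < P.card := by exact_mod_cast hP.card_pos
  refine le_of_le_of_eq ?_ (ncard_div_eq {x | x + σ ∈ B} P)
  rw [le_div_iff₀ hc] at *
  have e1 : B ∩ (P : Set Γ) = ((P.filter (fun x => x ∈ B) : Finset Γ) : Set Γ) := by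
    ext x; simp [and_comm]
  have e2 : (P : Set Γ) ∩ ((· + σ) '' (P : Set Γ)) = ((P ∩ P.image (· + σ) : Finset Γ) : Set Γ) := by
    simp
  have e3 : {x | x + σ ∈ B} ∩ (P : Set Γ) = ((P.filter (fun x => x + σ ∈ B) : Finset Γ) : Set Γ) := by
    ext x; simp [and_comm]
  rw [e1, Set.ncard_coe_finset] at h1
  rw [e2, Set.ncard_coe_finset] at h2
  rw [e3, Set.ncard_coe_finset]
  have h3 : (P.filter (fun x => x ∈ B)).card ≤
      (P.filter (fun x => x + σ ∈ B)).card + (P \ (P ∩ P.image (· + σ))).card := by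
    have : (P.filter (fun x => x ∈ B)) ⊆
      (P.filter (fun x => x + σ ∈ B)).image (· + σ) ∪ (P \ (P ∩ P.image (· + σ))) := by
      intro x hx
      simp only [Finset.mem_filter] at hx
      by_cases hi : x ∈ P.image (· + σ)
      · obtain ⟨y, hy, rfl⟩ := Finset.mem_image.1 hi
        exact Finset.mem_union_left _ (Finset.mem_image.2 ⟨y, by simp [hy, hx.2], rfl⟩)
      · apply Finset.mem_union_right
        simp only [Finset.mem_sdiff, Finset.mem_inter, hx.1, hi]; simp
    refine (Finset.card_le_card this).trans ((Finset.card_union_le _ _).trans ?_)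
    refine Nat.add_le_add_right ?_ _
    exact (Finset.card_image_le :
      ((P.filter (fun x => x + σ ∈ B)).image (· + σ)).card ≤ _)
  have h4 := Finset.card_sdiff_add_card_eq_card (Finset.inter_subset_left : P ∩ P.image (· + σ) ⊆ P)
  have h3' : ((P.filter (fun x => x ∈ B)).card : ℝ) ≤
      (P.filter (fun x => x + σ ∈ B)).card + (P \ (P ∩ P.image (· + σ))).card := by exact_mod_cast h3
  have h4' : ((P \ (P ∩ P.image (· + σ))).card : ℝ) + (P ∩ P.image (· + σ)).card = P.card := by
    exact_mod_cast h4
  nlinarith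

end USz

namespace USz

lemma ratio_nonneg {Γ : Type} (A : Set Γ) (P : Finset Γ) :
    0 ≤ ((A ∩ (P : Set Γ)).ncard : ℝ) / P.card := by positivity

lemma ratio_le_one {Γ : Type} (A : Set Γ) (P : Finset Γ) :
    ((A ∩ (P : Set Γ)).ncard : ℝ) / P.card ≤ 1 := by
  apply div_le_one_of_le₀ _ (by positivity)
  have := Set.ncard_le_ncard (Set.inter_subset_right : A ∩ (P : Set Γ) ⊆ P) P.finite_toSet
  rw [Set.ncard_coe_finset] at this
  exact_mod_cast this

lemma ncard_inter_map {Γ : Type} [AddCommGroup Γ] (A : Set Γ) (P : Finset Γ) (s : Γ) :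
    (A ∩ ((P.map (addRightEmbedding s) : Finset Γ) : Set Γ)).ncard =
      ({p | p + s ∈ A} ∩ (P : Set Γ)).ncard := by
  rw [← Set.ncard_image_of_injective ({p | p + s ∈ A} ∩ (P : Set Γ)) (addRightEmbedding s).injective]
  congr 1
  ext x
  constructor
  · rintro ⟨hx, hx2⟩
    simp only [Finset.coe_map, Set.mem_image] at hx2
    obtain ⟨y, hy, rfl⟩ := hx2
    exact ⟨y, ⟨hx, hy⟩, rfl⟩
  · rintro ⟨y, ⟨hx, hy⟩, rfl⟩
    refine ⟨hx, ?_⟩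
    simp only [Finset.coe_map]
    exact ⟨y, hy, rfl⟩

lemma dens_prod_eq {Γ : Type} (A : Set (Γ × Γ)) (P Q : Finset Γ) :
    ((A ∩ ((P ×ˢ Q : Finset (Γ × Γ)) : Set (Γ × Γ))).ncard : ℝ) / (P ×ˢ Q).card =
      dens {p : P × Q | ((p.1 : Γ), (p.2 : Γ)) ∈ A} := by
  rw [ncard_div_eq]
  let e : P × Q ≃ (P ×ˢ Q : Finset (Γ × Γ)) :=
    { toFun := fun p => ⟨(p.1, p.2), Finset.mem_product.2 ⟨p.1.2, p.2.2⟩⟩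
      invFun := fun x => (⟨x.1.1, (Finset.mem_product.1 x.2).1⟩, ⟨x.1.2, (Finset.mem_product.1 x.2).2⟩)
      left_inv := fun p => rfl
      right_inv := fun x => rfl }
  unfold dens
  rw [← avg_equiv e]
  rfl

lemma folner_prod {Γ : Type} [AddCommGroup Γ] {Φ : ℕ → Finset Γ} (hΦ : IsFolner Φ) (N : ℕ → ℕ)
    (hN : ∀ M, M ≤ N M) (s : ℕ → Γ × Γ) :
    IsFolner (fun M => (Φ (N M) ×ˢ Φ M).map (addRightEmbedding (s M))) := by
  refine ⟨fun M => ?_, ?_⟩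
  · simp [hΦ.1]
  rintro ⟨a, b⟩
  have h1 := (hΦ.2 a).comp (tendsto_atTop_mono hN tendsto_id)
  have h2 := h1.mul (hΦ.2 b)
  rw [one_mul] at h2
  refine h2.congr fun M => ?_
  simp only [Function.comp]
  rw [Set.inter_comm _ ((fun x => x + (a, b)) '' _), ncard_inter_map, Finset.card_map,
    Finset.card_product, div_mul_div_comm]
  push_cast
  congr 1
  rw [← Nat.cast_mul, ← Set.ncard_prod]
  congr 2
  ext ⟨x, y⟩
  simp only [Set.mem_inter_iff, Set.mem_prod, Set.mem_image, Set.mem_ofPred_eq, Finset.mem_coe,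
    Finset.mem_map, Finset.mem_product, Prod.exists, addRightEmbedding_apply, Prod.ext_iff,
    Prod.fst_add, Prod.snd_add]
  constructor
  · rintro ⟨⟨hx, x', hx', rfl⟩, hy, y', hy', rfl⟩
    refine ⟨⟨x' + (s M).1, y' + (s M).2, ⟨x', y', ⟨hx', hy'⟩, rfl, rfl⟩, ?_, ?_⟩, hx, hy⟩ <;> abel
  · rintro ⟨⟨x', y', ⟨x2, y2, ⟨h1, h2⟩, rfl, rfl⟩, h3, h4⟩, hx, hy⟩
    refine ⟨⟨hx, x2, h1, ?_⟩, hy, y2, h2, ?_⟩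
    · rw [add_right_comm] at h3; exact add_right_cancel h3
    · rw [add_right_comm] at h4; exact add_right_cancel h4

lemma le_ubd {Γ : Type} [AddCommGroup Γ] (A : Set Γ) (Φ : ℕ → Finset Γ) (hΦ : IsFolner Φ) {c : ℝ}
    (h : ∀ N, c ≤ ((A ∩ (Φ N : Set Γ)).ncard : ℝ) / (Φ N).card) : c ≤ upperBanachDensity A := by
  have hb : ∀ Ψ : ℕ → Finset Γ, IsBoundedUnder (· ≤ ·) atTop
      (fun N => ((A ∩ (Ψ N : Set Γ)).ncard : ℝ) / (Ψ N).card) := fun Ψ =>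
    isBoundedUnder_of ⟨1, fun N => ratio_le_one A (Ψ N)⟩
  have hcb : ∀ Ψ : ℕ → Finset Γ, IsCoboundedUnder (· ≤ ·) atTop
      (fun N => ((A ∩ (Ψ N : Set Γ)).ncard : ℝ) / (Ψ N).card) := fun Ψ =>
    (isBoundedUnder_of ⟨0, fun N => ratio_nonneg A (Ψ N)⟩ :
      IsBoundedUnder (· ≥ ·) atTop _).isCoboundedUnder_le
  refine le_trans (le_limsup_of_frequently_le (Frequently.of_forall h) (hb Φ)) ?_
  refine le_csSup ?_ ⟨Φ, hΦ, rfl⟩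
  refine ⟨1, ?_⟩
  rintro _ ⟨Ψ, -, rfl⟩
  exact limsup_le_of_le (hcb Ψ) (Eventually.of_forall fun N => ratio_le_one A (Ψ N))

lemma exists_folner {Γ : Type} [AddCommGroup Γ] (B : Set Γ) {δ η : ℝ} (hδ : 0 < δ) (hη : η < δ)
    (h : upperBanachDensity B = δ) : ∃ Φ : ℕ → Finset Γ, IsFolner Φ ∧
      ∃ᶠ N in atTop, η < ((B ∩ (Φ N : Set Γ)).ncard : ℝ) / (Φ N).card := by
  unfold upperBanachDensity at h
  have hne : {x : ℝ | ∃ Φ : ℕ → Finset Γ, IsFolner Φ ∧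
    x = limsup (fun N => ((B ∩ (Φ N : Set Γ)).ncard : ℝ) / (Φ N).card) atTop}.Nonempty := by
    by_contra hn
    rw [Set.not_nonempty_iff_eq_empty] at hn
    rw [hn, Real.sSup_empty] at h
    linarith
  obtain ⟨_, ⟨Φ, hΦ, rfl⟩, hx⟩ := exists_lt_of_lt_csSup hne (hη.trans_eq h.symm)
  refine ⟨Φ, hΦ, frequently_lt_of_lt_limsup ?_ hx⟩
  exact (isBoundedUnder_of ⟨0, fun N => ratio_nonneg B (Φ N)⟩ :
      IsBoundedUnder (· ≥ ·) atTop _).isCoboundedUnder_le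

lemma exists_cover {α : Type} [Finite α] {k : ℕ} (hα : Nat.card α = k + 1) (F : Finset ℤ)
    (hF : F.card ≤ k) : ∃ m : α → ℤ, ∀ z ∈ F, ∃ a, m a = z := by
  have := Fintype.ofFinite α
  rw [Nat.card_eq_fintype_card] at hα
  have : Nonempty (F ↪ α) := Function.Embedding.nonempty_of_card_le (by simp; omega)
  obtain ⟨f⟩ := this
  refine ⟨Function.extend f (fun z => (z : ℤ)) 0, fun z hz => ⟨f ⟨z, hz⟩, ?_⟩⟩
  rw [f.injective.extend_apply]

theorem main (δ : ℝ) (hδ : 0 < δ) (k : ℕ) :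
    ∃ c : ℝ, 0 < c ∧
      ∀ (Γ : Type) [AddCommGroup Γ] (B : Set Γ) (F : Finset ℤ),
        F.card ≤ k → upperBanachDensity B = δ →
        c ≤ upperBanachDensity {p : Γ × Γ | ∀ m ∈ F, p.1 + m • p.2 ∈ B} := by
  obtain ⟨α, _, hα, hD⟩ := dhj k
  have hne : Nonempty α := (Nat.card_pos_iff.1 (by omega)).1
  obtain ⟨n, hn⟩ := hD (δ / 4) (by linarith)
  refine ⟨δ / 4 / Nat.card (Fin n → α ⊕ Unit), div_pos (by linarith) card_pos', ?_⟩
  intro Γ _ B F hF hB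
  obtain ⟨m, hm⟩ := exists_cover hα F hF
  obtain ⟨Φ, hΦ, hf⟩ := exists_folner B (η := 3 * δ / 4) hδ (by linarith) hB
  have step : ∀ M, ∃ N, M ≤ N ∧ ∃ u v : Γ, δ / 4 / Nat.card (Fin n → α ⊕ Unit) ≤
      dens {p : Φ N × Φ M | ∀ a, ((p.1 : Γ) + u) + m a • ((p.2 : Γ) + v) ∈ B} := by
    intro M
    have hev : ∀ᶠ N in atTop, ∀ q : (Fin n → α) × (Fin n → Φ M),
        1 - δ / 4 < (((Φ N : Set Γ) ∩ ((· + ∑ i, m (q.1 i) • (q.2 i : Γ)) '' (Φ N : Set Γ))).ncard : ℝ)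
          / (Φ N).card := by
      rw [eventually_all]
      intro q
      exact (hΦ.2 _).eventually (lt_mem_nhds (by linarith))
    obtain ⟨N, hN1, hN2, hN3⟩ := (hf.and_eventually (hev.and (eventually_ge_atTop M))).exists
    refine ⟨N, hN3, core (by linarith) hn m B (Φ N) (Φ M) (hΦ.1 N) (hΦ.1 M) fun w d => ?_⟩
    have := dens_shift B (Φ N) (hΦ.1 N) _ hN1.le (hN2 (w, d)).le
    linarith
  choose N hN u v huv using step
  apply le_ubd _ _ (folner_prod hΦ N hN fun M => (u M, v M))
  intro M
  rw [ncard_inter_map, Finset.card_map, dens_prod_eq]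
  refine (huv M).trans (dens_mono ?_)
  intro p hp z hz
  obtain ⟨a, rfl⟩ := hm z hz
  exact hp a

end USz

/-- a uniform Szemerédi-type theorem. For every `δ > 0` and `k ∈ ℕ`
there is `c > 0` (depending only on `δ` and `k`) such that for every countable discrete
abelian group `Γ`, every `B ⊆ Γ` with upper Banach density `d*(B) = δ`, and every finite
`F ⊆ ℤ` with `|F| ≤ k`, the set
`R = {(γ₁,γ₂) ∈ Γ² : γ₁ + m γ₂ ∈ B for all m ∈ F}` has upper Banach density at least `c`
in `Γ²`. -/
theorem uniform_szemeredi_combinatorial (δ : ℝ) (hδ : 0 < δ) (k : ℕ) :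
    ∃ c : ℝ, 0 < c ∧
      ∀ (Γ : Type) [AddCommGroup Γ] [Countable Γ] (B : Set Γ) (F : Finset ℤ),
        F.card ≤ k → upperBanachDensity B = δ →
        c ≤ upperBanachDensity {p : Γ × Γ | ∀ m ∈ F, p.1 + m • p.2 ∈ B} := by
  obtain ⟨c, hc, h⟩ := USz.main δ hδ k
  exact ⟨c, hc, fun Γ _ _ B F hF hB => h Γ B F hF hB⟩
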